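/- arXiv:math/0409481 — 2 statements merged into one kernel-verified Lean document; each statement's English description precedes it below -/
import Mathlib

section
/- Let c, β > 0 and C ≥ 0 be constants, and let u, v, λ, η : [0,∞) × Ω → [0,∞) be measurable functions such that for each ω the map t ↦ u(t,ω) is continuous and the maps t ↦ v(t,ω), λ(t,ω), η(t,ω) are locally integrable, and assume: (i) u(t,ω) ≤ u(s,ω) + ∫_s^t ( −2c·v(r,ω) + 2·λ(r,ω)·u(r,ω) ) dr for all 0 ≤ s ≤ t and all ω; (ii) v(t,ω) ≥ β·u(t,ω) − C·η(t,ω) for all t ≥ 0 and ω; (iii) there is an integrable Q : Ω → [0,∞) with ∫_n^{n+1} λ(r,ω) dr ≤ Q(θ^n ω) for all n ∈ ℕ and ω, and E[Q] < c·β; (iv) there is a tempered b : Ω → [0,∞) with ∫_n^{n+1} η(s,ω) ds ≤ b(θ^n ω) for all n ∈ ℕ and ω; (v) ∫_n^{n+1} η(s,·) ds → 0 in probability as n → ∞. Then u(t,·) → 0 in probability as t → ∞. -/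
open Filter MeasureTheory intervalIntegral

/-- A measurable function `b : Ω → [0,∞)` is *tempered* with respect to an invertible
measure-preserving transformation `θ` (with inverse `θinv`) if for a.e. `ω` one has
`(1/|n|) · log⁺ b(θⁿ ω) → 0` as `|n| → ∞` (`n ∈ ℤ`), where `log⁺ t = max (log t) 0`. -/
def IsTempered {Ω : Type*} [MeasurableSpace Ω] (μ : MeasureTheory.Measure Ω)
    (θ θinv : Ω → Ω) (b : Ω → ℝ) : Prop :=
  ∀ᵐ ω ∂μ,
    Tendsto (fun n : ℕ => max (Real.log (b (θ^[n] ω))) 0 / (n : ℝ)) atTop (nhds 0) ∧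
    Tendsto (fun n : ℕ => max (Real.log (b (θinv^[n] ω))) 0 / (n : ℝ)) atTop (nhds 0)


lemma local_antitone {F : ℝ → ℝ} {a b d : ℝ} (hab : a ≤ b) (hd : 0 < d)
    (h : ∀ x y, a ≤ x → x ≤ y → y ≤ b → y - x ≤ d → F y ≤ F x) : F b ≤ F a := by
  obtain ⟨n, hn⟩ := exists_nat_gt ((b - a) / d)
  have hn0 : (0:ℝ) < n := lt_of_le_of_lt (div_nonneg (by linarith) hd.le) hn
  have hstep : (b - a) / n ≤ d := by
    rw [div_le_iff₀ hn0]; rw [div_lt_iff₀ hd] at hn; linarith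
  have hnn : 0 ≤ (b - a) / n := div_nonneg (by linarith) hn0.le
  have key : ∀ k : ℕ, k ≤ n → F (a + k * ((b - a) / n)) ≤ F a := by
    intro k
    induction k with
    | zero => intro _; simp
    | succ k ih =>
      intro hk
      refine le_trans (h _ _ ?_ ?_ ?_ ?_) (ih (by omega))
      · have : 0 ≤ (k:ℝ) * ((b - a) / n) := by positivity
        linarith
      · push_cast; linarith
      · have : ((k+1:ℕ):ℝ) * ((b - a) / n) ≤ n * ((b - a) / n) := by
          gcongr
        have h2 : (n:ℝ) * ((b - a) / n) = b - a := by field_simp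
        linarith
      · push_cast; linarith
  have := key n le_rfl
  have h2 : (n:ℝ) * ((b - a) / n) = b - a := by field_simp
  rw [h2] at this
  simpa using this

lemma gron_abs {u g h : ℝ → ℝ} {s T L : ℝ} (hsT : s ≤ T)
    (hu : ContinuousOn u (Set.Icc s T)) (hu0 : ∀ t, 0 ≤ u t)
    (hg : IntervalIntegrable g volume s T) (hh : IntervalIntegrable h volume s T)
    (hh0 : ∀ t, 0 ≤ h t)
    (hi : ∀ x y, s ≤ x → x ≤ y → y ≤ T → u y ≤ u x + ∫ r in x..y, (g r * u r + h r))
    (hL : ∀ x, s ≤ x → x ≤ T → Real.exp (-∫ r in s..x, g r) ≤ L) :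
    Real.exp (-∫ r in s..T, g r) * u T ≤ u s + L * ∫ r in s..T, h r := by
  have hL0 : 0 ≤ L := le_trans (Real.exp_pos _).le (hL s le_rfl hsT)
  have sub : ∀ {f : ℝ → ℝ}, IntervalIntegrable f volume s T → ∀ x y, s ≤ x → x ≤ y → y ≤ T →
      IntervalIntegrable f volume x y := by
    intro f hf x y h1 h2 h3
    refine hf.mono_set ?_
    rw [Set.uIcc_of_le h2, Set.uIcc_of_le hsT]
    exact Set.Icc_subset_Icc h1 h3
  have hgu : IntervalIntegrable (fun r => g r * u r) volume s T := by
    refine hg.mul_continuousOn ?_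
    rwa [Set.uIcc_of_le hsT]
  have hga : IntervalIntegrable (fun r => |g r|) volume s T := hg.abs
  have main : ∀ ε > 0, Real.exp (-∫ r in s..T, g r) * u T ≤
      u s + L * ∫ r in s..T, (h r + ε * |g r|) := by
    intro ε hε
    have huc := (isCompact_Icc.uniformContinuousOn_of_continuous hu)
    rw [Metric.uniformContinuousOn_iff] at huc
    obtain ⟨d, hd, hd'⟩ := huc ε hε
    have hhe : IntervalIntegrable (fun r => h r + ε * |g r|) volume s T := hh.add (hga.const_mul ε)
    have := local_antitone (F := fun z => Real.exp (-∫ r in s..z, g r) * u z -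
      L * ∫ r in s..z, (h r + ε * |g r|)) hsT (half_pos hd) ?_
    · simp only [intervalIntegral.integral_same, neg_zero, Real.exp_zero, one_mul, mul_zero,
        sub_zero] at this
      linarith
    intro x y hx hxy hy hyx
    have e1 : ∫ r in s..y, g r = (∫ r in s..x, g r) + ∫ r in x..y, g r :=
      (integral_add_adjacent_intervals (sub hg s x le_rfl hx (hxy.trans hy)) (sub hg x y hx hxy hy)).symm
    have e2 : ∫ r in s..y, (h r + ε * |g r|) = (∫ r in s..x, (h r + ε * |g r|)) + ∫ r in x..y, (h r + ε * |g r|) :=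
      (integral_add_adjacent_intervals (sub hhe s x le_rfl hx (hxy.trans hy)) (sub hhe x y hx hxy hy)).symm
    have b1 : ∫ r in x..y, (g r * u r + h r) ≤ ∫ r in x..y, (g r * u x + (h r + ε * |g r|)) := by
      refine integral_mono_on hxy ((sub hgu x y hx hxy hy).add (sub hh x y hx hxy hy))
        (((sub hg x y hx hxy hy).mul_const _).add (sub hhe x y hx hxy hy)) ?_
      intro r hr
      have hdist := hd' r ⟨hx.trans hr.1, hr.2.trans hy⟩ x ⟨hx, hxy.trans hy⟩ (by
        rw [Real.dist_eq, abs_of_nonneg (by linarith [hr.1])]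
        linarith [hr.2])
      rw [Real.dist_eq] at hdist
      have : g r * (u r - u x) ≤ |g r| * ε := by
        calc g r * (u r - u x) ≤ |g r * (u r - u x)| := le_abs_self _
          _ = |g r| * |u r - u x| := abs_mul _ _
          _ ≤ |g r| * ε := by gcongr
      linarith
    rw [integral_add ((sub hg x y hx hxy hy).mul_const _) (sub hhe x y hx hxy hy),
      intervalIntegral.integral_mul_const] at b1
    have b2 := hi x y hx hxy hy
    have pos : 0 ≤ ∫ r in x..y, (h r + ε * |g r|) :=
      integral_nonneg hxy fun r _ => add_nonneg (hh0 r) (by positivity)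
    set I := ∫ r in x..y, g r
    set J := ∫ r in x..y, (h r + ε * |g r|)
    have b3 : u y ≤ u x * Real.exp I + J := by
      have := mul_le_mul_of_nonneg_left (Real.add_one_le_exp I) (hu0 x)
      linarith
    have b4 := mul_le_mul_of_nonneg_left b3 (Real.exp_pos (-∫ r in s..y, g r)).le
    have b5 := mul_le_mul_of_nonneg_right (hL y (hx.trans hxy) hy) pos
    have b6 : Real.exp (-∫ r in s..y, g r) * Real.exp I = Real.exp (-∫ r in s..x, g r) := by
      rw [← Real.exp_add, e1]; congr 1; ring
    have b7 : Real.exp (-∫ r in s..y, g r) * (u x * Real.exp I + J) =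
      Real.exp (-∫ r in s..x, g r) * u x + Real.exp (-∫ r in s..y, g r) * J := by
      rw [← b6]; ring
    rw [e2]
    linarith
  refine le_of_forall_pos_le_add fun ε hε => ?_
  have hK : 0 ≤ ∫ r in s..T, |g r| := integral_nonneg hsT fun r _ => abs_nonneg _
  set K := ∫ r in s..T, |g r| with hKdef
  have := main (ε / (L * K + 1)) (by positivity)
  rw [integral_add hh (hga.const_mul _), intervalIntegral.integral_const_mul, ← hKdef] at this
  have h3 : L * (ε / (L * K + 1) * K) ≤ ε := by
    rw [div_mul_eq_mul_div, mul_div_assoc', div_le_iff₀ (by positivity)]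
    nlinarith
  linarith

lemma gron {u v l h : ℝ → ℝ} {s T c β C : ℝ} (hsT : s ≤ T) (hT1 : T ≤ s + 1)
    (hc : 0 < c) (hβ : 0 < β) (hC : 0 ≤ C)
    (hu : ContinuousOn u (Set.Icc s T)) (hu0 : ∀ t, 0 ≤ u t)
    (hv : IntervalIntegrable v volume s T)
    (hl : IntervalIntegrable l volume s T) (hh : IntervalIntegrable h volume s T)
    (hl0 : ∀ t, 0 ≤ l t) (hh0 : ∀ t, 0 ≤ h t)
    (hi : ∀ x y, s ≤ x → x ≤ y → y ≤ T → u y ≤ u x + ∫ r in x..y, (-(2 * c) * v r + 2 * l r * u r))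
    (hii : ∀ x, s ≤ x → v x ≥ β * u x - C * h x) :
    u T ≤ Real.exp (2 * (∫ r in s..T, l r) - 2 * (c * β) * (T - s)) *
      (u s + Real.exp (2 * (c * β)) * (2 * c * C) * ∫ r in s..T, h r) := by
  have sub : ∀ {f : ℝ → ℝ}, IntervalIntegrable f volume s T → ∀ x y, s ≤ x → x ≤ y → y ≤ T →
      IntervalIntegrable f volume x y := by
    intro f hf x y h1 h2 h3
    refine hf.mono_set ?_
    rw [Set.uIcc_of_le h2, Set.uIcc_of_le hsT]
    exact Set.Icc_subset_Icc h1 h3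
  have hg : IntervalIntegrable (fun r => 2 * l r - 2 * (c * β)) volume s T :=
    (hl.const_mul 2).sub intervalIntegrable_const
  have hgu : IntervalIntegrable (fun r => (2 * l r - 2 * (c * β)) * u r) volume s T := by
    refine hg.mul_continuousOn ?_
    rwa [Set.uIcc_of_le hsT]
  have hlu : IntervalIntegrable (fun r => (2 * l r) * u r) volume s T := by
    refine (hl.const_mul 2).mul_continuousOn ?_
    rwa [Set.uIcc_of_le hsT]
  have hH : IntervalIntegrable (fun r => 2 * c * C * h r) volume s T := hh.const_mul _
  have eg : ∀ x, s ≤ x → x ≤ T → ∫ r in s..x, (2 * l r - 2 * (c * β)) =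
      2 * (∫ r in s..x, l r) - 2 * (c * β) * (x - s) := by
    intro x h1 h2
    rw [integral_sub ((sub hl s x le_rfl h1 h2).const_mul 2) intervalIntegrable_const,
      intervalIntegral.integral_const_mul, intervalIntegral.integral_const]
    simp; ring
  have hcb : 0 < c * β := by positivity
  have := gron_abs (u := u) (g := fun r => 2 * l r - 2 * (c * β)) (h := fun r => 2 * c * C * h r)
    (L := Real.exp (2 * (c * β))) hsT hu hu0 hg hH (fun t => by have := hh0 t; positivity) ?_ ?_
  · rw [eg T hsT le_rfl, intervalIntegral.integral_const_mul, Real.exp_neg,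
      inv_mul_le_iff₀ (Real.exp_pos _)] at this
    rw [mul_assoc (Real.exp (2 * (c * β)))]
    exact this
  · intro x y hx hxy hy
    refine (hi x y hx hxy hy).trans ?_
    gcongr
    refine integral_mono_on hxy (((sub hv x y hx hxy hy).const_mul _).add (sub hlu x y hx hxy hy))
      ((sub hgu x y hx hxy hy).add (sub hH x y hx hxy hy)) ?_
    intro r hr
    have := mul_le_mul_of_nonneg_left (hii r (hx.trans hr.1)) (by positivity : 0 ≤ 2 * c)
    linarith
  · intro x hx hxT
    rw [eg x hx hxT]
    refine Real.exp_le_exp.2 ?_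
    have : 0 ≤ ∫ r in s..x, l r := integral_nonneg hx fun r _ => hl0 r
    nlinarith

/-- Running maxima of Birkhoff sums. -/
noncomputable def runMax {Ω : Type*} (T : Ω → Ω) (f : Ω → ℝ) : ℕ → Ω → ℝ
  | 0 => fun _ => 0
  | n + 1 => fun ω => max 0 (f ω + runMax T f n (T ω))

lemma runMax_nonneg {Ω : Type*} (T : Ω → Ω) (f : Ω → ℝ) (n : ℕ) (ω : Ω) : 0 ≤ runMax T f n ω := by
  cases n with
  | zero => exact le_rfl
  | succ n => exact le_max_left _ _

lemma runMax_succ_le {Ω : Type*} (T : Ω → Ω) (f : Ω → ℝ) (n : ℕ) :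
    ∀ ω, runMax T f n ω ≤ runMax T f (n + 1) ω := by
  induction n with
  | zero => intro ω; exact runMax_nonneg _ _ _ _
  | succ n ih =>
    intro ω
    exact max_le_max le_rfl (by have := ih (T ω); linarith)

lemma runMax_mono {Ω : Type*} (T : Ω → Ω) (f : Ω → ℝ) (ω : Ω) :
    Monotone (fun n => runMax T f n ω) := monotone_nat_of_le_succ fun n => runMax_succ_le T f n ω

lemma birkhoff_le_runMax {Ω : Type*} (T : Ω → Ω) (f : Ω → ℝ) (n : ℕ) :
    ∀ ω, birkhoffSum T f n ω ≤ runMax T f n ω := by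
  induction n with
  | zero => intro ω; simp [runMax]
  | succ n ih =>
    intro ω
    rw [birkhoffSum_succ']
    refine le_trans ?_ (le_max_right _ _)
    have := ih (T ω)
    linarith

lemma runMax_meas {Ω : Type*} [MeasurableSpace Ω] {T : Ω → Ω} {f : Ω → ℝ} (hT : Measurable T)
    (hf : Measurable f) (n : ℕ) : Measurable (runMax T f n) := by
  induction n with
  | zero => exact measurable_const
  | succ n ih => exact measurable_const.max (hf.add (ih.comp hT))

lemma runMax_integrable {Ω : Type*} [MeasurableSpace Ω] {μ : Measure Ω} {T : Ω → Ω} {f : Ω → ℝ}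
    (hT : MeasurePreserving T μ μ) (hf : Integrable f μ) (n : ℕ) :
    Integrable (runMax T f n) μ := by
  induction n with
  | zero => exact integrable_zero _ _ _
  | succ n ih =>
    have h1 : Integrable (fun ω => runMax T f n (T ω)) μ := hT.integrable_comp_of_integrable ih
    exact (integrable_zero Ω ℝ μ).sup (hf.add h1)

lemma birkhoff_bdd {Ω : Type*} [MeasurableSpace Ω] {μ : Measure Ω} [IsProbabilityMeasure μ]
    {T : Ω → Ω} {f : Ω → ℝ}
    (hT : Ergodic T μ) (hfm : Measurable f) (hf : Integrable f μ) (hneg : ∫ ω, f ω ∂μ < 0) :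
    ∀ᵐ ω ∂μ, BddAbove (Set.range fun n => birkhoffSum T f n ω) := by
  have hmp := hT.toMeasurePreserving
  set A : Set Ω := {ω | BddAbove (Set.range fun n => runMax T f n ω)} with hA
  have hAm : MeasurableSet A := measurableSet_bddAbove_range fun n => runMax_meas hmp.measurable hfm n
  have hinv : T ⁻¹' A = A := by
    ext ω
    simp only [hA, Set.mem_preimage, Set.mem_ofPred_eq]
    constructor
    · rintro ⟨B, hB⟩
      refine ⟨max 0 (f ω + B), ?_⟩
      rintro _ ⟨n, rfl⟩
      refine (runMax_succ_le T f n ω).trans ?_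
      refine max_le_max le_rfl ?_
      have := hB ⟨n, rfl⟩
      simp only at this
      linarith
    · rintro ⟨B, hB⟩
      refine ⟨B - f ω, ?_⟩
      rintro _ ⟨n, rfl⟩
      have := hB ⟨n + 1, rfl⟩
      have h2 : f ω + runMax T f n (T ω) ≤ runMax T f (n + 1) ω := le_max_right _ _
      simp only at this ⊢
      linarith
  rcases hT.toPreErgodic.ae_mem_or_ae_notMem hAm hinv with h | h
  · filter_upwards [h] with ω hω
    obtain ⟨B, hB⟩ := hω
    refine ⟨B, ?_⟩
    rintro _ ⟨n, rfl⟩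
    exact (birkhoff_le_runMax T f n ω).trans (hB ⟨n, rfl⟩)
  · exfalso
    have hlim : Tendsto (fun n => ∫ ω, max (-runMax T f n (T ω)) (f ω) ∂μ) atTop
        (nhds (∫ ω, f ω ∂μ)) := by
      refine tendsto_integral_of_dominated_convergence (fun ω => |f ω|) ?_ hf.abs ?_ ?_
      · intro n
        exact (((runMax_meas hmp.measurable hfm n).comp hmp.measurable).neg.max
          hfm).aestronglyMeasurable
      · intro n
        filter_upwards with ω
        have h0 := runMax_nonneg T f n (T ω)
        rw [Real.norm_eq_abs, abs_le]
        refine ⟨(neg_abs_le _).trans (le_max_right _ _), max_le ?_ (le_abs_self _)⟩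
        have := abs_nonneg (f ω)
        linarith
      · have h' : ∀ᵐ ω ∂μ, T ω ∉ A := hmp.quasiMeasurePreserving.ae h
        filter_upwards [h'] with ω hω
        have ht : Tendsto (fun n => runMax T f n (T ω)) atTop atTop :=
          tendsto_atTop_atTop_of_monotone' (runMax_mono T f (T ω)) hω
        refine tendsto_const_nhds.congr' ?_
        filter_upwards [ht.eventually_ge_atTop (-f ω)] with n hn
        exact (max_eq_right (by linarith)).symm
    have hge : ∀ n, 0 ≤ ∫ ω, max (-runMax T f n (T ω)) (f ω) ∂μ := by
      intro n
      have i1 := runMax_integrable hmp hf (n + 1)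
      have i0 := runMax_integrable hmp hf n
      have i2 : Integrable (fun ω => runMax T f n (T ω)) μ := hmp.integrable_comp_of_integrable i0
      have e : ∀ ω, max (-runMax T f n (T ω)) (f ω) = runMax T f (n + 1) ω - runMax T f n (T ω) := by
        intro ω
        simp only [runMax]
        rw [← max_sub_sub_right]; congr 1 <;> ring
      simp_rw [e]
      rw [integral_sub i1 i2]
      have e2 : ∫ ω, runMax T f n (T ω) ∂μ = ∫ ω, runMax T f n ω ∂μ := by
        have := integral_map (μ := μ) hmp.measurable.aemeasurable (f := runMax T f n)
          (by rw [hmp.map_eq]; exact i0.aestronglyMeasurable)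
        rw [hmp.map_eq] at this
        exact this.symm
      rw [e2]
      have := integral_mono i0 i1 (runMax_succ_le T f n)
      linarith
    have := ge_of_tendsto' hlim hge
    linarith

/-- A sequence of measurable functions a.e. bounded above has a measurable bound. -/
lemma exists_meas_bound {Ω : Type*} [MeasurableSpace Ω] {μ : Measure Ω} {Y : ℕ → Ω → ℝ}
    (hY : ∀ n, Measurable (Y n)) (hb : ∀ᵐ ω ∂μ, BddAbove (Set.range fun n => Y n ω)) :
    ∃ G : Ω → ℝ, Measurable G ∧ (∀ ω, 0 ≤ G ω) ∧ ∀ᵐ ω ∂μ, ∀ n, Y n ω ≤ G ω := by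
  refine ⟨fun ω => max 0 (⨆ n, Y n ω), measurable_const.max (Measurable.iSup hY),
    fun ω => le_max_left _ _, ?_⟩
  filter_upwards [hb] with ω hω n
  exact (le_ciSup hω n).trans (le_max_right _ _)

lemma birkhoff_bound {Ω : Type*} [MeasurableSpace Ω] {μ : Measure Ω} [IsProbabilityMeasure μ]
    {T : Ω → Ω} {f : Ω → ℝ}
    (hT : Ergodic T μ) (hf : Integrable f μ) (hneg : ∫ ω, f ω ∂μ < 0) :
    ∃ G : Ω → ℝ, Measurable G ∧ (∀ ω, 0 ≤ G ω) ∧ ∀ᵐ ω ∂μ, ∀ n, birkhoffSum T f n ω ≤ G ω := by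
  obtain ⟨f', hf'm, hff'⟩ := hf.aestronglyMeasurable.aemeasurable
  have hf' : Integrable f' μ := hf.congr hff'
  have hneg' : ∫ ω, f' ω ∂μ < 0 := by rwa [← integral_congr_ae hff']
  have hTm := hT.toMeasurePreserving.measurable
  have hm : ∀ n, Measurable (fun ω => birkhoffSum T f' n ω) := by
    intro n
    unfold birkhoffSum
    exact Finset.measurable_fun_sum _ fun i _ => hf'm.comp (hTm.iterate i)
  obtain ⟨G, h1, h2, h3⟩ := exists_meas_bound hm (birkhoff_bdd hT hf'm hf' hneg')
  refine ⟨G, h1, h2, ?_⟩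
  have hall : ∀ᵐ ω ∂μ, ∀ i, f (T^[i] ω) = f' (T^[i] ω) := by
    rw [ae_all_iff]
    intro i
    exact (hT.toMeasurePreserving.iterate i).quasiMeasurePreserving.ae hff'
  filter_upwards [h3, hall] with ω a1 a2 n
  refine le_trans (le_of_eq ?_) (a1 n)
  exact Finset.sum_congr rfl fun i _ => a2 i

/-- A tempered function grows subexponentially along backward orbits. -/
lemma tempered_bdd {x : ℕ → ℝ} {γ : ℝ} (hγ : 0 < γ)
    (h : Tendsto (fun n : ℕ => max (Real.log (x n)) 0 / (n : ℝ)) atTop (nhds 0)) :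
    BddAbove (Set.range fun n : ℕ => Real.exp (-γ) ^ n * x n) := by
  refine Filter.IsBoundedUnder.bddAbove_range (Filter.isBoundedUnder_of_eventually_le (a := 1) ?_)
  filter_upwards [h.eventually_lt_const hγ, eventually_gt_atTop 0] with n hn hn0
  have hn0' : (0:ℝ) < n := by exact_mod_cast hn0
  rw [div_lt_iff₀ hn0'] at hn
  rw [← Real.exp_nat_mul]
  rcases le_or_gt (x n) 0 with hx | hx
  · exact (mul_nonpos_of_nonneg_of_nonpos (Real.exp_pos _).le hx).trans zero_le_one
  · rw [← Real.exp_log hx, ← Real.exp_add, ← Real.exp_zero, Real.exp_le_exp]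
    have := le_max_left (Real.log (x n)) 0
    nlinarith

/-- Convergence to zero in measure from above. -/
def TM {Ω : Type*} [MeasurableSpace Ω] (μ : Measure Ω) (X : ℕ → Ω → ℝ) : Prop :=
  ∀ ε : ℝ, 0 < ε → Tendsto (fun n => μ {ω | ε ≤ X n ω}) atTop (nhds 0)

section TM
variable {Ω : Type*} [MeasurableSpace Ω] {μ : Measure Ω}

lemma TM.of_ae [IsProbabilityMeasure μ] {X : ℕ → Ω → ℝ} (hX : ∀ n, Measurable (X n))
    (h : ∀ᵐ ω ∂μ, Tendsto (fun n => X n ω) atTop (nhds 0)) : TM μ X := by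
  have := tendstoInMeasure_of_tendsto_ae (g := fun _ => (0:ℝ)) (fun n => (hX n).aestronglyMeasurable (μ := μ)) h
  rw [tendstoInMeasure_iff_norm] at this
  intro ε hε
  refine tendsto_of_tendsto_of_tendsto_of_le_of_le tendsto_const_nhds (this ε hε)
    (fun n => zero_le) (fun n => measure_mono ?_)
  intro ω hω
  have hω' : ε ≤ X n ω := hω
  change ε ≤ ‖X n ω - 0‖
  rw [sub_zero, Real.norm_eq_abs]
  exact hω'.trans (le_abs_self _)

lemma TM.mono {X Y : ℕ → Ω → ℝ} (hY : TM μ Y) (h : ∀ n, ∀ᵐ ω ∂μ, X n ω ≤ Y n ω) : TM μ X := by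
  intro ε hε
  refine tendsto_of_tendsto_of_tendsto_of_le_of_le tendsto_const_nhds (hY ε hε)
    (fun n => zero_le) (fun n => measure_mono_ae ?_)
  filter_upwards [h n] with ω hω (h1 : ε ≤ X n ω)
  exact h1.trans hω

lemma TM.add {X Y : ℕ → Ω → ℝ} (hX : TM μ X) (hY : TM μ Y) : TM μ (fun n ω => X n ω + Y n ω) := by
  intro ε hε
  have := (hX _ (half_pos hε)).add (hY _ (half_pos hε))
  rw [add_zero] at this
  refine tendsto_of_tendsto_of_tendsto_of_le_of_le tendsto_const_nhds this
    (fun n => zero_le) (fun n => (measure_mono ?_).trans (measure_union_le _ _))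
  intro ω hω
  have hω' : ε ≤ X n ω + Y n ω := hω
  by_contra hc
  have h1 : ¬ (ε / 2 ≤ X n ω) := fun h => hc (Or.inl h)
  have h2 : ¬ (ε / 2 ≤ Y n ω) := fun h => hc (Or.inr h)
  linarith

lemma TM.zero : TM μ (fun _ _ => 0) := by
  intro ε hε
  have : ∀ n : ℕ, {ω : Ω | ε ≤ (fun (_ : ℕ) (_ : Ω) => (0:ℝ)) n ω} = ∅ := by
    intro n; ext ω; simpa using hε
  exact tendsto_const_nhds.congr fun n => by rw [this n, measure_empty]

lemma TM.const_mul {X : ℕ → Ω → ℝ} (hX : TM μ X) {K : ℝ} (hK : 0 ≤ K) :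
    TM μ (fun n ω => K * X n ω) := by
  rcases hK.eq_or_lt with rfl | hK
  · simpa using TM.zero
  intro ε hε
  have := hX (ε / K) (by positivity)
  refine this.congr fun n => ?_
  congr 1
  ext ω
  change ε / K ≤ X n ω ↔ ε ≤ K * X n ω
  rw [div_le_iff₀ hK, mul_comm]

lemma TM.sum {X : ℕ → ℕ → Ω → ℝ} (hX : ∀ j, TM μ (X j)) (m : ℕ) :
    TM μ (fun n ω => ∑ j ∈ Finset.range m, X j n ω) := by
  induction m with
  | zero => simpa using TM.zero
  | succ m ih => simp_rw [Finset.sum_range_succ]; exact ih.add (hX m)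

lemma TM.shift {X : ℕ → Ω → ℝ} (hX : TM μ X) (j : ℕ) : TM μ (fun n => X (n - j)) :=
  fun ε hε => (hX ε hε).comp (tendsto_sub_atTop_nat j)

lemma meas_comp_le {θ : Ω → Ω} (hθ : MeasurePreserving θ μ μ) {Y : Ω → ℝ} (hY : Measurable Y)
    (n : ℕ) (L : ℝ) : μ {ω | L ≤ Y (θ^[n] ω)} = μ {ω | L ≤ Y ω} :=
  (hθ.iterate n).measure_preimage (measurableSet_le measurable_const hY).nullMeasurableSet

lemma TM.prod [IsProbabilityMeasure μ] {θ : Ω → Ω} (hθ : MeasurePreserving θ μ μ) {Y : Ω → ℝ}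
    (hY : Measurable Y) {X : ℕ → Ω → ℝ} (hX0 : ∀ n ω, 0 ≤ X n ω) (hX : TM μ X) :
    TM μ (fun n ω => Y (θ^[n] ω) * X n ω) := by
  intro ε hε
  rw [ENNReal.tendsto_nhds_zero]
  intro δ hδ
  have h1 : TM μ (fun n ω => Y ω / ((n:ℝ) + 1)) := by
    refine TM.of_ae (fun n => hY.div_const _) (Eventually.of_forall fun ω => ?_)
    exact tendsto_const_nhds.div_atTop (tendsto_natCast_atTop_atTop.atTop_add tendsto_const_nhds)
  have hδ2 : 0 < δ / 2 := ENNReal.half_pos hδ.ne'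
  obtain ⟨k, hk⟩ := ((ENNReal.tendsto_nhds_zero.1 (h1 1 one_pos)) _ hδ2).exists
  have hk1 : (0:ℝ) < (k:ℝ) + 1 := by positivity
  filter_upwards [ENNReal.tendsto_nhds_zero.1 (hX (ε / ((k:ℝ) + 1)) (by positivity)) _ hδ2] with n hn
  rw [← ENNReal.add_halves δ]
  refine le_trans ?_ (add_le_add hk hn)
  rw [← meas_comp_le hθ (hY.div_const _) n]
  refine (measure_mono ?_).trans (measure_union_le _ _)
  intro ω hω
  have hω' : ε ≤ Y (θ^[n] ω) * X n ω := hω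
  by_contra hc
  have a1 : ¬ (1 ≤ Y (θ^[n] ω) / ((k:ℝ) + 1)) := fun h => hc (Or.inl h)
  have a2 : ¬ (ε / ((k:ℝ) + 1) ≤ X n ω) := fun h => hc (Or.inr h)
  rw [le_div_iff₀ hk1, not_le, one_mul] at a1
  rw [div_le_iff₀ hk1, not_le] at a2
  have := mul_le_mul_of_nonneg_right a1.le (hX0 n ω)
  linarith

lemma TM.split {θ : Ω → Ω} (hθ : MeasurePreserving θ μ μ)
    {X R : ℕ → Ω → ℝ} {A : ℕ → ℕ → Ω → ℝ} (hA : ∀ m, TM μ (A m)) (hRm : ∀ m, Measurable (R m))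
    (hR : TM μ R) (h : ∀ m n, m ≤ n → ∀ᵐ ω ∂μ, X n ω ≤ A m n ω + R m (θ^[n] ω)) : TM μ X := by
  intro ε hε
  rw [ENNReal.tendsto_nhds_zero]
  intro δ hδ
  have hδ2 : 0 < δ / 2 := ENNReal.half_pos hδ.ne'
  obtain ⟨m, hm⟩ := ((ENNReal.tendsto_nhds_zero.1 (hR _ (half_pos hε))) _ hδ2).exists
  filter_upwards [ENNReal.tendsto_nhds_zero.1 (hA m _ (half_pos hε)) _ hδ2,
    eventually_ge_atTop m] with n hn hmn
  rw [← ENNReal.add_halves δ]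
  refine le_trans ?_ (add_le_add hn hm)
  rw [← meas_comp_le hθ (hRm m) n]
  refine (measure_mono_ae ?_).trans (measure_union_le _ _)
  filter_upwards [h m n hmn] with ω hω (h1 : ε ≤ X n ω)
  by_contra hc
  have a1 : ¬ (ε / 2 ≤ A m n ω) := fun h => hc (Or.inl h)
  have a2 : ¬ (ε / 2 ≤ R m (θ^[n] ω)) := fun h => hc (Or.inr h)
  linarith

end TM

lemma discrete_gron {a Q e : ℕ → ℝ} {κ : ℝ}
    (h : ∀ n, a (n + 1) ≤ Real.exp (2 * (Q n - κ)) * (a n + e n)) (n : ℕ) :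
    Real.exp (2 * (Q n - κ)) * (a n + e n) ≤
      Real.exp (2 * ∑ i ∈ Finset.Ico 0 (n + 1), (Q i - κ)) * a 0 +
      ∑ k ∈ Finset.range (n + 1), Real.exp (2 * ∑ i ∈ Finset.Ico k (n + 1), (Q i - κ)) * e k := by
  induction n with
  | zero => simp; exact le_of_eq (by ring)
  | succ n ih =>
    have h1 := (h n).trans ih
    have h2 := mul_le_mul_of_nonneg_left (add_le_add_left h1 (e (n + 1)))
      (Real.exp_pos (2 * (Q (n + 1) - κ))).le
    refine h2.trans (le_of_eq ?_)
    have key : ∀ k, k ≤ n + 1 → Real.exp (2 * ∑ i ∈ Finset.Ico k (n + 1 + 1), (Q i - κ)) =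
        Real.exp (2 * (Q (n + 1) - κ)) * Real.exp (2 * ∑ i ∈ Finset.Ico k (n + 1), (Q i - κ)) := by
      intro k hk
      rw [← Real.exp_add, Finset.sum_Ico_succ_top hk]
      congr 1; ring
    have hs : ∑ k ∈ Finset.range (n + 1),
        Real.exp (2 * ∑ i ∈ Finset.Ico k (n + 1 + 1), (Q i - κ)) * e k =
        Real.exp (2 * (Q (n + 1) - κ)) * ∑ k ∈ Finset.range (n + 1),
          Real.exp (2 * ∑ i ∈ Finset.Ico k (n + 1), (Q i - κ)) * e k := by
      rw [Finset.mul_sum]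
      refine Finset.sum_congr rfl fun k hk => ?_
      rw [key k (Finset.mem_range.1 hk).le, mul_assoc]
    rw [Finset.sum_range_succ _ (n + 1), hs, key 0 (by omega), key (n + 1) le_rfl,
      Finset.Ico_self, Finset.sum_empty, mul_zero, Real.exp_zero]
    ring

lemma birkhoff_inv {Ω : Type*} {θ θinv : Ω → Ω} (hinv : Function.LeftInverse θinv θ) (f : Ω → ℝ)
    (n k : ℕ) (hk : k ≤ n) (ω : Ω) :
    ∑ i ∈ Finset.Ico k (n + 1), f (θ^[i] ω) = birkhoffSum θinv f (n + 1 - k) (θ^[n] ω) := by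
  unfold birkhoffSum
  rw [Finset.sum_Ico_eq_sum_range, ← Finset.sum_range_reflect]
  refine Finset.sum_congr rfl fun j hj => ?_
  have hj' := Finset.mem_range.1 hj
  have : n = j + (k + (n + 1 - k - 1 - j)) := by omega
  conv_rhs => rw [this, Function.iterate_add_apply, hinv.iterate j]

/-- Let `θ` be an invertible ergodic measure-preserving transformation
of a probability space.  Let `c, β > 0`, `C ≥ 0` and let `u, v, λ, η ≥ 0` on
`[0,∞) × Ω` be measurable, with `t ↦ u t ω` continuous and `t ↦ v t ω, λ t ω, η t ω`
locally integrable, such that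
(i)  `u t ω ≤ u s ω + ∫_s^t (−2c·v r ω + 2·λ r ω·u r ω) dr` for `0 ≤ s ≤ t`;
(ii) `v t ω ≥ β·u t ω − C·η t ω` for `t ≥ 0`;
(iii) there is an integrable `Q ≥ 0` with `∫_n^{n+1} λ ≤ Q(θ^n ω)` and `E[Q] < c·β`;
(iv) there is a tempered `b ≥ 0` with `∫_n^{n+1} η ≤ b(θ^n ω)`;
(v)  `∫_n^{n+1} η(s,·) ds → 0` in probability.
Then `u t · → 0` in probability as `t → ∞`. -/
theorem statement7
    {Ω : Type*} [MeasurableSpace Ω] {μ : Measure Ω} [IsProbabilityMeasure μ]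
    {θ θinv : Ω → Ω}
    (hinv₁ : Function.LeftInverse θinv θ) (hinv₂ : Function.RightInverse θinv θ)
    (hθ : Ergodic θ μ) (hθinv : MeasurePreserving θinv μ μ)
    {c β C : ℝ} (hc : 0 < c) (hβ : 0 < β) (hC : 0 ≤ C)
    {u v lam η : ℝ → Ω → ℝ}
    (hu_meas : Measurable (Function.uncurry u)) (hv_meas : Measurable (Function.uncurry v))
    (hlam_meas : Measurable (Function.uncurry lam)) (hη_meas : Measurable (Function.uncurry η))
    (hu_nonneg : ∀ t ω, 0 ≤ u t ω) (hv_nonneg : ∀ t ω, 0 ≤ v t ω)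
    (hlam_nonneg : ∀ t ω, 0 ≤ lam t ω) (hη_nonneg : ∀ t ω, 0 ≤ η t ω)
    (hu_cont : ∀ ω, ContinuousOn (fun t => u t ω) (Set.Ici (0 : ℝ)))
    (hv_int : ∀ ω, ∀ t, 0 ≤ t → IntervalIntegrable (fun r => v r ω) volume 0 t)
    (hlam_int : ∀ ω, ∀ t, 0 ≤ t → IntervalIntegrable (fun r => lam r ω) volume 0 t)
    (hη_int : ∀ ω, ∀ t, 0 ≤ t → IntervalIntegrable (fun r => η r ω) volume 0 t)
    (hi : ∀ ω, ∀ s t : ℝ, 0 ≤ s → s ≤ t →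
      u t ω ≤ u s ω + ∫ r in s..t, (-(2 * c) * v r ω + 2 * lam r ω * u r ω))
    (hii : ∀ ω, ∀ t : ℝ, 0 ≤ t → v t ω ≥ β * u t ω - C * η t ω)
    (hiii : ∃ Q : Ω → ℝ, Integrable Q μ ∧ (∀ ω, 0 ≤ Q ω) ∧
      (∀ n : ℕ, ∀ ω, (∫ r in (n : ℝ)..((n : ℝ) + 1), lam r ω) ≤ Q (θ^[n] ω)) ∧
      ∫ ω, Q ω ∂μ < c * β)
    (hiv : ∃ b : Ω → ℝ, Measurable b ∧ (∀ ω, 0 ≤ b ω) ∧ IsTempered μ θ θinv b ∧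
      ∀ n : ℕ, ∀ ω, (∫ s in (n : ℝ)..((n : ℝ) + 1), η s ω) ≤ b (θ^[n] ω))
    (hv' : TendstoInMeasure μ
      (fun n : ℕ => fun ω => ∫ s in (n : ℝ)..((n : ℝ) + 1), η s ω) atTop 0) :
    TendstoInMeasure μ (fun t : ℝ => fun ω => u t ω) atTop 0 := by
  obtain ⟨Q, hQi, hQ0, hQ, hQE⟩ := hiii
  obtain ⟨b, hbm, hb0, hbt, hb⟩ := hiv
  have hmp := hθ.toMeasurePreserving
  have herg : Ergodic θinv μ := by
    refine ⟨hθinv, ⟨fun s hs hs' => hθ.toPreErgodic.aeconst_set hs ?_⟩⟩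
    conv_lhs => rw [← hs']
    ext ω
    simp only [Set.mem_preimage]
    rw [hinv₁ ω]
  obtain ⟨κ, hκ⟩ : ∃ κ, κ = c * β := ⟨_, rfl⟩
  have hκ0 : 0 < κ := by rw [hκ]; positivity
  rw [← hκ] at hQE
  obtain ⟨a, ha⟩ : ∃ a, a = (∫ ω, Q ω ∂μ + κ) / 2 := ⟨_, rfl⟩
  have ha1 : ∫ ω, Q ω ∂μ < a := by linarith
  have ha2 : 0 < κ - a := by linarith
  obtain ⟨r, hr⟩ : ∃ r, r = Real.exp (-(κ - a)) := ⟨_, rfl⟩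
  have hr0 : 0 < r := hr ▸ Real.exp_pos _
  have hr1 : r < 1 := by rw [hr, Real.exp_lt_one_iff]; linarith
  have hneg : ∫ ω, (Q ω - a) ∂μ < 0 := by
    rw [integral_sub hQi (integrable_const a)]; simp; linarith
  obtain ⟨G, hGm, hG0, hG⟩ := birkhoff_bound herg (hQi.sub (integrable_const a)) hneg
  have hθim : Measurable θinv := hθinv.measurable
  obtain ⟨N, hNm, hN0, hN⟩ := exists_meas_bound (μ := μ) (Y := fun n ω => r ^ n * b (θinv^[n] ω))
    (fun n => measurable_const.mul (hbm.comp (hθim.iterate n)))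
    (by
      filter_upwards [hbt] with ω hω
      rw [hr]
      exact tempered_bdd ha2 hω.2)
  obtain ⟨K, hK⟩ : ∃ K, K = Real.exp (2 * κ) * (2 * c * C) := ⟨_, rfl⟩
  have hK0 : 0 ≤ K := by rw [hK]; positivity
  set E : ℕ → Ω → ℝ := fun n ω => ∫ s in (n : ℝ)..((n : ℝ) + 1), η s ω with hE
  have hE0 : ∀ n ω, 0 ≤ E n ω := fun n ω => integral_nonneg (by linarith) fun s _ => hη_nonneg s ω
  have hETM : TM μ E := by
    intro ε hε
    rw [tendstoInMeasure_iff_norm] at hv'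
    refine (hv' ε hε).congr fun n => ?_
    congr 1
    ext ω
    change ε ≤ ‖E n ω - 0‖ ↔ ε ≤ E n ω
    rw [sub_zero, Real.norm_of_nonneg (hE0 n ω)]
  have hq0 : 0 < r * r := by positivity
  have hq1 : r * r < 1 := by nlinarith
  have hu0m : Measurable (u 0) := hu_meas.comp (measurable_const.prodMk measurable_id)
  set D : ℕ → Ω → ℝ := fun n ω => (r * r) ^ n * u 0 ω +
    K * ∑ j ∈ Finset.range (n + 1), (r * r) ^ j * E (n - j) ω with hD
  have hD0 : ∀ n ω, 0 ≤ D n ω := by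
    intro n ω
    have h1 := hu_nonneg 0 ω
    have h2 : 0 ≤ ∑ j ∈ Finset.range (n + 1), (r * r) ^ j * E (n - j) ω :=
      Finset.sum_nonneg fun j _ => mul_nonneg (by positivity) (hE0 _ _)
    simp only [hD]
    positivity
  have hDTM : TM μ D := by
    refine TM.split hmp (A := fun m n ω => (r * r) ^ n * u 0 ω +
      K * ∑ j ∈ Finset.range m, (r * r) ^ j * E (n - j) ω)
      (R := fun m ω => r ^ m * (K * (1 / (1 - r) * N ω))) ?_ ?_ ?_ ?_
    · intro m
      refine TM.add (TM.of_ae (fun n => measurable_const.mul hu0m) (Eventually.of_forall fun ω => ?_))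
        (TM.const_mul (TM.sum (X := fun j n ω => (r * r) ^ j * E (n - j) ω)
          (fun j => TM.const_mul (hETM.shift j) (by positivity)) m) hK0)
      simpa using (tendsto_pow_atTop_nhds_zero_of_lt_one hq0.le hq1).mul_const (u 0 ω)
    · intro m
      fun_prop
    · refine TM.of_ae (fun n => by fun_prop) (Eventually.of_forall fun ω => ?_)
      simpa using (tendsto_pow_atTop_nhds_zero_of_lt_one hr0.le hr1).mul_const
        (K * (1 / (1 - r) * N ω))
    · intro m n hmn
      filter_upwards [(hmp.iterate n).quasiMeasurePreserving.ae hN] with ω hω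
      have hsplit := Finset.sum_range_add_sum_Ico (fun j => (r * r) ^ j * E (n - j) ω)
        (show m ≤ n + 1 by omega)
      simp only [hD]
      rw [← hsplit]
      have htail : ∑ j ∈ Finset.Ico m (n + 1), (r * r) ^ j * E (n - j) ω ≤
          r ^ m / (1 - r) * N (θ^[n] ω) := by
        calc ∑ j ∈ Finset.Ico m (n + 1), (r * r) ^ j * E (n - j) ω
            ≤ ∑ j ∈ Finset.Ico m (n + 1), r ^ j * N (θ^[n] ω) := by
              refine Finset.sum_le_sum fun j hj => ?_
              have hj' := Finset.mem_Ico.1 hj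
              have e1 : θinv^[j] (θ^[n] ω) = θ^[n - j] ω := by
                have : n = j + (n - j) := by omega
                conv_lhs => rw [this, Function.iterate_add_apply, hinv₁.iterate j]
              have h1 := hω j
              rw [e1] at h1
              rw [mul_pow, mul_assoc]
              refine mul_le_mul_of_nonneg_left (le_trans ?_ h1) (by positivity)
              exact mul_le_mul_of_nonneg_left (hb _ _) (by positivity)
          _ = (∑ j ∈ Finset.Ico m (n + 1), r ^ j) * N (θ^[n] ω) := by rw [Finset.sum_mul]
          _ ≤ r ^ m / (1 - r) * N (θ^[n] ω) :=
              mul_le_mul_of_nonneg_right (geom_sum_Ico_le_of_lt_one hr0.le hr1) (hN0 _)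
      have h2 := mul_le_mul_of_nonneg_left htail hK0
      have h3 : K * (r ^ m / (1 - r) * N (θ^[n] ω)) =
        r ^ m * (K * (1 / (1 - r) * N (θ^[n] ω))) := by ring
      linarith
  have hXTM : TM μ (fun n ω => Real.exp (2 * κ + 2 * G (θ^[n] ω)) * D n ω) :=
    TM.prod hmp (Y := fun ω => Real.exp (2 * κ + 2 * G ω)) (by fun_prop) hD0 hDTM
  -- one-step estimate
  have hstep : ∀ ω (n : ℕ) (t : ℝ), (n : ℝ) ≤ t → t ≤ n + 1 →
      u t ω ≤ Real.exp (2 * Q (θ^[n] ω) - 2 * κ * (t - n)) * (u n ω + K * E n ω) := by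
    intro ω n t hnt htn
    have hn0 : (0:ℝ) ≤ n := Nat.cast_nonneg n
    have ii : ∀ {f : ℝ → ℝ}, (∀ t, 0 ≤ t → IntervalIntegrable f volume 0 t) → ∀ t, (n:ℝ) ≤ t →
        IntervalIntegrable f volume n t := fun hf t ht =>
      (hf n hn0).symm.trans (hf t (hn0.trans ht))
    have h := gron (u := fun t => u t ω) (v := fun t => v t ω) (l := fun t => lam t ω)
      (h := fun t => η t ω) hnt htn hc hβ hC
      ((hu_cont ω).mono fun x hx => hn0.trans hx.1) (fun t => hu_nonneg t ω)
      (ii (hv_int ω) t hnt) (ii (hlam_int ω) t hnt) (ii (hη_int ω) t hnt)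
      (fun t => hlam_nonneg t ω) (fun t => hη_nonneg t ω)
      (fun x y hx hxy _ => hi ω x y (hn0.trans hx) hxy)
      (fun x hx => hii ω x (hn0.trans hx))
    rw [← hκ, ← hK] at h
    have mono : ∀ {f : ℝ → ℝ}, (∀ t, 0 ≤ f t) → (∀ t, 0 ≤ t → IntervalIntegrable f volume 0 t) →
        ∫ x in (n:ℝ)..t, f x ≤ ∫ x in (n:ℝ)..((n:ℝ) + 1), f x := fun h0 hf =>
      integral_mono_interval le_rfl hnt htn (Eventually.of_forall h0) (ii hf _ (by linarith))
    have m1 := (mono (fun t => hlam_nonneg t ω) (hlam_int ω)).trans (hQ n ω)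
    have m2 := mono (fun t => hη_nonneg t ω) (hη_int ω)
    refine h.trans (mul_le_mul (Real.exp_le_exp.2 (by linarith)) ?_ ?_ (Real.exp_pos _).le)
    · have := mul_le_mul_of_nonneg_left m2 hK0
      simp only [hE]
      linarith
    · have h1 : 0 ≤ ∫ r in (n:ℝ)..t, η r ω := integral_nonneg hnt fun s _ => hη_nonneg s ω
      have h2 := hu_nonneg n ω
      positivity
  have hbound : ∀ n : ℕ, ∀ᵐ ω ∂μ, ∀ t : ℝ, (n : ℝ) ≤ t → t ≤ n + 1 →
      u t ω ≤ Real.exp (2 * κ + 2 * G (θ^[n] ω)) * D n ω := by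
    intro n
    filter_upwards [(hmp.iterate n).quasiMeasurePreserving.ae hG] with ω hω t hnt htn
    have hd := discrete_gron (a := fun n => u n ω) (Q := fun n => Q (θ^[n] ω))
      (e := fun n => K * E n ω) (κ := κ) (fun k => by
        have := hstep ω k ((k:ℝ) + 1) (by linarith) le_rfl
        push_cast
        refine this.trans (le_of_eq ?_)
        congr 2; ring) n
    have hexp : ∀ k, k ≤ n → Real.exp (2 * ∑ i ∈ Finset.Ico k (n + 1), (Q (θ^[i] ω) - κ)) ≤
        Real.exp (2 * G (θ^[n] ω)) * (r * r) ^ (n - k) := by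
      intro k hk
      have h1 := hω (n + 1 - k)
      rw [← birkhoff_inv hinv₁ _ n k hk] at h1
      have h2 : ∑ i ∈ Finset.Ico k (n + 1), (Q (θ^[i] ω) - κ) =
          ∑ i ∈ Finset.Ico k (n + 1), (Q (θ^[i] ω) - a) - ((n - k : ℕ) + 1) * (κ - a) := by
        have : ((n - k : ℕ) : ℝ) + 1 = (Finset.Ico k (n + 1)).card := by
          rw [Nat.card_Ico, show n + 1 - k = (n - k) + 1 by omega]; push_cast; ring
        rw [this, ← nsmul_eq_mul, ← Finset.sum_const, ← Finset.sum_sub_distrib]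
        exact Finset.sum_congr rfl fun i _ => by ring
      rw [hr, ← Real.exp_add, ← Real.exp_nat_mul, ← Real.exp_add, Real.exp_le_exp, h2]
      have h3 : ∑ i ∈ Finset.Ico k (n + 1), (Q (θ^[i] ω) - a) ≤ G (θ^[n] ω) := h1
      linarith
    have h4 : Real.exp (2 * Q (θ^[n] ω) - 2 * κ * (t - n)) * (u n ω + K * E n ω) ≤
        Real.exp (2 * κ) * (Real.exp (2 * (Q (θ^[n] ω) - κ)) * (u n ω + K * E n ω)) := by
      rw [← mul_assoc, ← Real.exp_add]
      have p1 := hu_nonneg n ω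
      have p2 := mul_nonneg hK0 (hE0 n ω)
      refine mul_le_mul_of_nonneg_right (Real.exp_le_exp.2 ?_) (by positivity)
      have : 0 ≤ κ * (t - n) := mul_nonneg hκ0.le (by linarith)
      linarith
    refine ((hstep ω n t hnt htn).trans h4).trans ?_
    rw [Real.exp_add, mul_assoc (Real.exp (2 * κ))]
    refine mul_le_mul_of_nonneg_left (hd.trans ?_) (Real.exp_pos _).le
    simp only [hD]
    rw [mul_add, Finset.mul_sum _ _ K, Finset.mul_sum _ _ (Real.exp (2 * G (θ^[n] ω))),
      ← Finset.sum_range_reflect (fun k => Real.exp (2 * ∑ i ∈ Finset.Ico k (n + 1), (Q (θ^[i] ω) - κ)) * (K * E k ω))]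
    refine add_le_add ?_ (Finset.sum_le_sum fun j hj => ?_)
    · rw [← mul_assoc, Nat.cast_zero]
      exact mul_le_mul_of_nonneg_right (hexp 0 (Nat.zero_le _)) (hu_nonneg _ _)
    · have hj' := Finset.mem_range.1 hj
      have e : n + 1 - 1 - j = n - j := by omega
      rw [e]
      refine (mul_le_mul_of_nonneg_right (hexp (n - j) (by omega))
        (mul_nonneg hK0 (hE0 _ _))).trans (le_of_eq ?_)
      rw [show n - (n - j) = j by omega]
      ring
  rw [tendstoInMeasure_iff_norm]
  intro ε hε
  have hfin := (hXTM ε hε).comp (tendsto_nat_floor_atTop (α := ℝ))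
  refine tendsto_of_tendsto_of_tendsto_of_le_of_le' tendsto_const_nhds hfin
    (Eventually.of_forall fun n => zero_le) ?_
  filter_upwards [eventually_ge_atTop (0:ℝ)] with t ht
  refine measure_mono_ae ?_
  filter_upwards [hbound ⌊t⌋₊] with ω hω h1
  have h1' : ε ≤ ‖u t ω - 0‖ := h1
  rw [sub_zero, Real.norm_of_nonneg (hu_nonneg t ω)] at h1'
  exact h1'.trans (hω t (Nat.floor_le ht) (Nat.lt_floor_add_one t).le)
end

section
/- For every measurable x : Ω → [0,∞), exactly one of the following two alternatives holds: either (1/n)·log⁺ x(θ^n ω) → 0 as n → ∞ for almost every ω, or limsup_{n→∞} (1/n)·log⁺ x(θ^n ω) = +∞ for almost every ω. -/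
open Filter MeasureTheory

/-- Running maximum of Birkhoff sums, defined recursively. -/
noncomputable def maxSum {Ω : Type*} (θ : Ω → Ω) (φ : Ω → ℝ) : ℕ → Ω → ℝ
  | 0 => fun _ => 0
  | N + 1 => fun ω => max 0 (φ ω + maxSum θ φ N (θ ω))

lemma maxSum_nonneg {Ω : Type*} (θ : Ω → Ω) (φ : Ω → ℝ) (N : ℕ) (ω : Ω) :
    0 ≤ maxSum θ φ N ω := by
  cases N with
  | zero => simp [maxSum]
  | succ N => simp [maxSum]

lemma maxSum_mono {Ω : Type*} (θ : Ω → Ω) (φ : Ω → ℝ) (N : ℕ) : ∀ ω : Ω,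
    maxSum θ φ N ω ≤ maxSum θ φ (N + 1) ω := by
  induction N with
  | zero => intro ω; simp [maxSum]
  | succ N ih =>
    intro ω
    have h := ih (θ ω)
    rw [maxSum, maxSum]
    exact max_le_max le_rfl (by linarith)

lemma sum_le_maxSum {Ω : Type*} (θ : Ω → Ω) (φ : Ω → ℝ) (N : ℕ) : ∀ ω : Ω,
    ∑ j ∈ Finset.range N, φ (θ^[j] ω) ≤ maxSum θ φ N ω := by
  induction N with
  | zero => intro ω; simp [maxSum]
  | succ N ih =>
    intro ω
    have h := ih (θ ω)
    rw [Finset.sum_range_succ', maxSum]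
    simp only [Function.iterate_succ, Function.comp, Function.iterate_zero, id] at h ⊢
    exact le_max_of_le_right (by linarith)

lemma maxSum_measurable {Ω : Type*} [MeasurableSpace Ω] {θ : Ω → Ω} (hθ : Measurable θ)
    {φ : Ω → ℝ} (hφ : Measurable φ) (N : ℕ) : Measurable (maxSum θ φ N) := by
  induction N with
  | zero => exact measurable_const
  | succ N ih => exact measurable_const.max (hφ.add (ih.comp hθ))

lemma maxSum_integrable {Ω : Type*} [MeasurableSpace Ω] {μ : Measure Ω} [IsProbabilityMeasure μ]
    {θ : Ω → Ω} (hθ : MeasurePreserving θ μ μ)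
    {φ : Ω → ℝ} (hφ : Integrable φ μ) (N : ℕ) : Integrable (maxSum θ φ N) μ := by
  induction N with
  | zero => exact integrable_const _
  | succ N ih =>
    exact (integrable_const (0 : ℝ)).sup (hφ.add (hθ.integrable_comp_of_integrable ih))

lemma maximal_aux {Ω : Type*} [MeasurableSpace Ω] {μ : Measure Ω} [IsProbabilityMeasure μ]
    {θ : Ω → Ω} (hθ : MeasurePreserving θ μ μ)
    {φ : Ω → ℝ} (hφm : Measurable φ) (hφ : Integrable φ μ) (N : ℕ) :
    0 ≤ ∫ ω in {ω | 0 < maxSum θ φ N ω}, φ ω ∂μ := by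
  have hE : MeasurableSet {ω | 0 < maxSum θ φ N ω} :=
    measurableSet_lt measurable_const (maxSum_measurable hθ.measurable hφm N)
  have hI := maxSum_integrable hθ hφ N
  have hI' : Integrable (fun ω => maxSum θ φ N (θ ω)) μ := hθ.integrable_comp_of_integrable hI
  have h0 : ∫ ω, (maxSum θ φ N ω - maxSum θ φ N (θ ω)) ∂μ = 0 := by
    rw [integral_sub hI hI']
    have := integral_map (μ := μ) hθ.measurable.aemeasurable
      (f := maxSum θ φ N) (by rw [hθ.map_eq]; exact hI.aestronglyMeasurable)
    rw [hθ.map_eq] at this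
    linarith
  rw [← integral_indicator hE]
  refine h0.ge.trans ?_
  refine integral_mono (hI.sub hI') (hφ.indicator hE) fun ω => ?_
  by_cases h : 0 < maxSum θ φ N ω
  · rw [Set.indicator_of_mem (by exact h)]
    cases N with
    | zero => simp [maxSum] at h
    | succ N =>
      have h2 := maxSum_mono θ φ N (θ ω)
      have h3 : maxSum θ φ (N + 1) ω = φ ω + maxSum θ φ N (θ ω) := by
        rw [maxSum] at h ⊢
        rcases max_choice 0 (φ ω + maxSum θ φ N (θ ω)) with h4 | h4
        · simp [h4] at h
        · exact h4
      simp only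
      linarith
  · rw [Set.indicator_of_notMem (by exact h)]
    have h2 := maxSum_nonneg θ φ N (θ ω)
    simp only
    linarith [not_lt.1 h]

lemma maximal_ineq {Ω : Type*} [MeasurableSpace Ω] {μ : Measure Ω} [IsProbabilityMeasure μ]
    {θ : Ω → Ω} (hθ : MeasurePreserving θ μ μ) {B : Set Ω} (hB : MeasurableSet B)
    {ε : ℝ} (hε : 0 < ε) :
    μ {ω | ∃ n : ℕ, ε * n < ∑ j ∈ Finset.range n, B.indicator (fun _ => (1 : ℝ)) (θ^[j] ω)}
      ≤ ENNReal.ofReal (μ.real B / ε) := by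
  set φ : Ω → ℝ := fun ω => B.indicator (fun _ => (1 : ℝ)) ω - ε with hφd
  have hm1 : Measurable (B.indicator (fun _ => (1 : ℝ))) := measurable_const.indicator hB
  have hφm : Measurable φ := hm1.sub measurable_const
  have hi1 : Integrable (B.indicator (fun _ => (1 : ℝ))) μ := (integrable_const _).indicator hB
  have hφ : Integrable φ μ := hi1.sub (integrable_const _)
  have hmono : Monotone fun N => {ω | 0 < maxSum θ φ N ω} :=
    monotone_nat_of_le_succ fun N ω h => lt_of_lt_of_le h (maxSum_mono θ φ N ω)
  have hsub : {ω | ∃ n : ℕ, ε * n < ∑ j ∈ Finset.range n,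
      B.indicator (fun _ => (1 : ℝ)) (θ^[j] ω)} ⊆ ⋃ N, {ω | 0 < maxSum θ φ N ω} := by
    rintro ω ⟨n, hn⟩
    refine Set.mem_iUnion.2 ⟨n, lt_of_lt_of_le ?_ (sum_le_maxSum θ φ n ω)⟩
    simp only [hφd, Finset.sum_sub_distrib, Finset.sum_const, Finset.card_range, nsmul_eq_mul]
    linarith
  refine (measure_mono hsub).trans ?_
  rw [hmono.measure_iUnion]
  refine iSup_le fun N => ?_
  have h := maximal_aux hθ hφm hφ N
  set E := {ω | 0 < maxSum θ φ N ω}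
  rw [integral_sub hi1.integrableOn (integrable_const _), integral_indicator hB] at h
  simp only [integral_const, smul_eq_mul, mul_one, measureReal_restrict_apply_univ,
    measureReal_restrict_apply MeasurableSet.univ, Set.univ_inter,
    measureReal_restrict_apply hB] at h
  have h2 : (μ.restrict E).real B ≤ μ.real B := by
    rw [measureReal_restrict_apply hB]; exact measureReal_mono Set.inter_subset_left
  rw [← ENNReal.ofReal_toReal (measure_ne_top μ E)]
  refine ENNReal.ofReal_le_ofReal ?_
  rw [le_div_iff₀ hε]
  change μ.real E * ε ≤ _
  have h3 : μ.real (B ∩ E) ≤ μ.real B := measureReal_mono Set.inter_subset_left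
  linarith

/-- deterministic counting step -/
lemma count_step {Ω : Type*} {θ : Ω → Ω} {f : Ω → ℝ} {C : ℕ} (hC : 1 ≤ C) (K : ℕ) {δ : ℝ}
    (hδ : 0 < δ) (hδ1 : δ ≤ 1) {ω : Ω} (h : ∃ᶠ n : ℕ in atTop, δ * n < f (θ^[n] ω)) :
    ∃ n : ℕ, δ / (4 * C) * n < ∑ j ∈ Finset.range n,
      ({ω | ∀ n : ℕ, f (θ^[n] ω) ≤ C * n + K}ᶜ : Set Ω).indicator (fun _ => (1 : ℝ))
        (θ^[j] ω) := by
  have hC' : (1 : ℝ) ≤ C := by exact_mod_cast hC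
  obtain ⟨n, hn, hnl⟩ := (h.and_eventually
    (eventually_ge_atTop (⌈(2 * (K + C) : ℝ) / δ⌉₊ + 1))).exists
  have hn1 : (2 * (K + C) : ℝ) / δ ≤ n := by
    refine (Nat.le_ceil _).trans (Nat.cast_le.2 ?_)
    omega
  rw [div_le_iff₀ hδ] at hn1
  have hn0 : (1 : ℝ) ≤ n := by exact_mod_cast (by omega)
  refine ⟨n, ?_⟩
  set m := ⌈δ / (2 * C) * n⌉₊ with hm
  have hm1 : δ / (2 * C) * n ≤ m := Nat.le_ceil _
  have hm2 : (m : ℝ) < δ / (2 * C) * n + 1 := Nat.ceil_lt_add_one (by positivity)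
  have hCm : C * (δ / (2 * C) * n) = δ * n / 2 := by field_simp
  have hm3 : (C : ℝ) * m + K ≤ δ * n := by nlinarith
  have hmn : m ≤ n := by
    have : (m : ℝ) ≤ n := by
      have : (0:ℝ) ≤ K := by positivity
      nlinarith
    exact_mod_cast this
  have hpos : δ / (4 * C) * n < δ / (2 * C) * n := by
    have : δ / (4 * C) * n = (δ / (2 * C) * n) / 2 := by field_simp; norm_num
    have : 0 < δ / (2 * C) * n := by positivity
    linarith
  refine hpos.trans_le (hm1.trans ?_)
  have hsub : Finset.Ico (n - m) n ⊆ Finset.range n := by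
    intro j hj; simp at hj ⊢; omega
  refine le_trans ?_ (Finset.sum_le_sum_of_subset_of_nonneg hsub
    fun j _ _ => Set.indicator_nonneg (fun _ _ => zero_le_one) _)
  rw [Finset.sum_congr rfl (g := fun _ => (1 : ℝ))]
  · simp only [Finset.sum_const, Nat.card_Ico, nsmul_eq_mul, mul_one]
    exact_mod_cast (by omega)
  · intro j hj
    rw [Finset.mem_Ico] at hj
    refine Set.indicator_of_mem ?_ _
    intro hall
    have h1 := hall (n - j)
    rw [← Function.iterate_add_apply, Nat.sub_add_cancel hj.2.le] at h1
    have h2 : ((n - j : ℕ) : ℝ) ≤ m := by exact_mod_cast (by omega)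
    nlinarith

lemma bdd_case {Ω : Type*} [MeasurableSpace Ω] {μ : Measure Ω} [IsProbabilityMeasure μ]
    {θ : Ω → Ω} (hθ : MeasurePreserving θ μ μ) {f : Ω → ℝ} (hf : Measurable f)
    {C : ℕ} (hC : 1 ≤ C)
    (h : ∀ᵐ ω ∂μ, ∃ K : ℕ, ∀ n : ℕ, f (θ^[n] ω) ≤ C * n + K) {δ : ℝ}
    (hδ : 0 < δ) (hδ1 : δ ≤ 1) :
    ∀ᵐ ω ∂μ, ∀ᶠ n : ℕ in atTop, f (θ^[n] ω) ≤ δ * n := by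
  have hC' : (1 : ℝ) ≤ C := by exact_mod_cast hC
  set B : ℕ → Set Ω := fun K => {ω | ∀ n : ℕ, f (θ^[n] ω) ≤ C * n + K} with hBd
  have hB : ∀ K, MeasurableSet (B K) := fun K => by
    simp only [hBd, Set.ofPred_forall]
    exact MeasurableSet.iInter fun n =>
      measurableSet_le (hf.comp (hθ.measurable.iterate n)) measurable_const
  have hanti : Antitone fun K => (B K)ᶜ := by
    intro K L hKL
    refine Set.compl_subset_compl.2 fun ω hω n => (hω n).trans ?_
    have : (K : ℝ) ≤ L := by exact_mod_cast hKL
    linarith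
  have hnull : μ (⋂ K, (B K)ᶜ) = 0 := by
    rw [ae_iff] at h
    convert h using 2
    ext ω
    simp [hBd]
  have hlim := tendsto_measure_iInter_atTop (μ := μ) (fun K => (hB K).compl.nullMeasurableSet)
    hanti ⟨0, measure_ne_top _ _⟩
  rw [hnull] at hlim
  have hlim2 : Tendsto (fun K => ENNReal.ofReal (μ.real (B K)ᶜ / (δ / (4 * C)))) atTop
      (nhds 0) := by
    have h1 := (ENNReal.tendsto_toReal ENNReal.zero_ne_top).comp hlim
    have h2 := ENNReal.tendsto_ofReal (h1.div_const (δ / (4 * C)))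
    simpa [Measure.real] using h2
  rw [ae_iff]
  refine le_antisymm (ge_of_tendsto' hlim2 fun K => ?_) bot_le
  refine le_trans (measure_mono ?_) (maximal_ineq hθ (hB K).compl (by positivity))
  intro ω hω
  refine count_step hC K hδ hδ1 ?_
  refine (Filter.not_eventually.1 hω).mono fun n hn => not_le.1 hn


/-- Let `θ` be a measure-preserving ergodic transformation of a
probability space.  For every measurable `x : Ω → [0,∞)`, exactly one of the following
two alternatives holds: either `(1/n) · log⁺ x(θ^n ω) → 0` as `n → ∞` for almost every
`ω`, or `limsup_{n→∞} (1/n) · log⁺ x(θ^n ω) = +∞` for almost every `ω` (the latter being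
expressed as: for every `M`, frequently `(1/n) · log⁺ x(θ^n ω) > M`). -/
theorem statement9
    {Ω : Type*} [MeasurableSpace Ω] {μ : Measure Ω} [IsProbabilityMeasure μ]
    {θ : Ω → Ω} (hθ : Ergodic θ μ)
    {x : Ω → ℝ} (hx_meas : Measurable x) (hx_nonneg : ∀ ω, 0 ≤ x ω) :
    Xor'
      (∀ᵐ ω ∂μ, Tendsto (fun n : ℕ => max (Real.log (x (θ^[n] ω))) 0 / (n : ℝ))
        atTop (nhds 0))
      (∀ᵐ ω ∂μ, ∀ M : ℝ, ∃ᶠ n : ℕ in atTop,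
        M < max (Real.log (x (θ^[n] ω))) 0 / (n : ℝ)) := by
  set f : Ω → ℝ := fun ω => max (Real.log (x ω)) 0 with hfd
  have hf : Measurable f := (Real.measurable_log.comp hx_meas).max measurable_const
  have hf0 : ∀ ω, 0 ≤ f ω := fun ω => le_max_right _ _
  change Xor' (∀ᵐ ω ∂μ, Tendsto (fun n : ℕ => f (θ^[n] ω) / (n : ℝ)) atTop (nhds 0))
      (∀ᵐ ω ∂μ, ∀ M : ℝ, ∃ᶠ n : ℕ in atTop, M < f (θ^[n] ω) / (n : ℝ))
  have hexcl : ¬ ((∀ᵐ ω ∂μ, Tendsto (fun n : ℕ => f (θ^[n] ω) / (n : ℝ)) atTop (nhds 0)) ∧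
      (∀ᵐ ω ∂μ, ∀ M : ℝ, ∃ᶠ n : ℕ in atTop, M < f (θ^[n] ω) / (n : ℝ))) := by
    rintro ⟨h1, h2⟩
    obtain ⟨ω, h1, h2⟩ := (h1.and h2).exists
    obtain ⟨n, h3, h4⟩ := ((h2 1).and_eventually (h1.eventually_lt_const one_pos)).exists
    exact lt_asymm h3 h4
  have hor : (∀ᵐ ω ∂μ, Tendsto (fun n : ℕ => f (θ^[n] ω) / (n : ℝ)) atTop (nhds 0)) ∨
      (∀ᵐ ω ∂μ, ∀ M : ℝ, ∃ᶠ n : ℕ in atTop, M < f (θ^[n] ω) / (n : ℝ)) := by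
    set A : ℕ → Set Ω := fun C => {ω | ∃ K : ℕ, ∀ n : ℕ, f (θ^[n] ω) ≤ C * n + K} with hAd
    have hAm : ∀ C, MeasurableSet (A C) := fun C => by
      simp only [hAd, Set.ofPred_exists, Set.ofPred_forall]
      exact MeasurableSet.iUnion fun K => MeasurableSet.iInter fun n =>
        measurableSet_le (hf.comp (hθ.measurable.iterate n)) measurable_const
    have hinv : ∀ C, θ ⁻¹' (A C) = A C := fun C => by
      ext ω
      constructor
      · rintro ⟨K, hK⟩
        refine ⟨K + ⌈f ω⌉₊, fun n => ?_⟩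
        have h1 := Nat.le_ceil (f ω)
        cases n with
        | zero =>
          simp only [Function.iterate_zero, id]
          push_cast
          have : (0 : ℝ) ≤ K := by positivity
          linarith
        | succ n =>
          have h2 := hK n
          rw [← Function.iterate_succ_apply] at h2
          push_cast
          have : (0 : ℝ) ≤ C := by positivity
          linarith [hf0 ω]
      · rintro ⟨K, hK⟩
        refine ⟨K + C, fun n => ?_⟩
        have h2 := hK (n + 1)
        rw [Function.iterate_succ_apply] at h2
        push_cast at h2 ⊢
        linarith
    by_cases hex : ∃ C, 1 ≤ C ∧ ∀ᵐ ω ∂μ, ω ∈ A C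
    · left
      obtain ⟨C, hC, hAC⟩ := hex
      have key : ∀ᵐ ω ∂μ, ∀ k : ℕ, ∀ᶠ n : ℕ in atTop, f (θ^[n] ω) ≤ (1 / ((k : ℝ) + 1)) * n :=
        ae_all_iff.2 fun k => bdd_case hθ.toMeasurePreserving hf hC hAC (by positivity)
          (by rw [div_le_one (by positivity)]; linarith [(Nat.cast_nonneg k : (0 : ℝ) ≤ k)])
      filter_upwards [key] with ω hω
      rw [Metric.tendsto_atTop']
      intro ε hε
      obtain ⟨k, hk⟩ := exists_nat_one_div_lt hε
      obtain ⟨N, hN⟩ := eventually_atTop.1 (hω k)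
      refine ⟨N, fun n hn => ?_⟩
      have hn0 : (0 : ℝ) < n := by exact_mod_cast (by omega)
      rw [Real.dist_eq, sub_zero, abs_of_nonneg (div_nonneg (hf0 _) hn0.le)]
      exact lt_of_le_of_lt ((div_le_iff₀ hn0).2 (hN n hn.le)) hk
    · right
      have hnot : ∀ᵐ ω ∂μ, ∀ C : ℕ, 1 ≤ C → ω ∉ A C := by
        refine ae_all_iff.2 fun C => ?_
        by_cases hC : 1 ≤ C
        · rcases hθ.toPreErgodic.ae_mem_or_ae_notMem (hAm C) (hinv C) with h | h
          · exact absurd ⟨C, hC, h⟩ hex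
          · filter_upwards [h] with ω hω _ using hω
        · exact Eventually.of_forall fun ω h => absurd h hC
      filter_upwards [hnot] with ω hω M
      by_contra hM
      rw [Filter.not_frequently] at hM
      obtain ⟨N, hN⟩ := eventually_atTop.1 hM
      refine hω (⌈M⌉₊ + 1) (by omega) ⟨⌈∑ j ∈ Finset.range (N + 1), f (θ^[j] ω)⌉₊, fun n => ?_⟩
      have h1 := Nat.le_ceil (∑ j ∈ Finset.range (N + 1), f (θ^[j] ω))
      by_cases hn : n < N + 1
      · have h2 := Finset.single_le_sum (f := fun j => f (θ^[j] ω)) (fun j _ => hf0 _)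
          (Finset.mem_range.2 hn)
        have : (0 : ℝ) ≤ ((⌈M⌉₊ + 1 : ℕ) : ℝ) * n := by positivity
        linarith
      · have h2 := not_lt.1 (hN n (by omega))
        have hn0 : (0 : ℝ) < n := by exact_mod_cast (by omega)
        rw [div_le_iff₀ hn0] at h2
        have h3 := Nat.le_ceil M
        have h4 : (0 : ℝ) ≤ (⌈∑ j ∈ Finset.range (N + 1), f (θ^[j] ω)⌉₊ : ℝ) := by positivity
        push_cast
        nlinarith
  rcases hor with h | h
  · exact Or.inl ⟨h, fun h' => hexcl ⟨h, h'⟩⟩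
  · exact Or.inr ⟨h, fun h' => hexcl ⟨h', h⟩⟩
end
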